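/- arXiv:2009.03345 — 2 statements merged into one kernel-verified Lean document; each statement's English description precedes it below -/
import Mathlib

section
/- For every integer n ≥ 2, the ratio of discriminants Δ(Ψ_n(x))/Δ(Φ_n(x)) equals 2^{φ(n)}/p if n = p^α is a prime power, and equals 2^{φ(n)} otherwise. -/
open Polynomial

/-- The Fibonacci polynomials: `F 1 = 1`, `F 2 = X`, `F (n+2) = X * F (n+1) + F n`. -/
noncomputable def fibPoly : ℕ → Polynomial ℤ
  | 0 => 0
  | 1 => 1
  | n + 2 => X * fibPoly (n + 1) + fibPoly n

/-- The discriminant (in the sense `∏_{i ≠ j} (rᵢ - rⱼ)`) of a monic polynomial that splits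
over `ℂ`, computed as `∏_i f'(rᵢ)` over the roots of `f`. -/
noncomputable def discC (f : Polynomial ℂ) : ℂ :=
  (f.roots.map (fun a => f.derivative.eval a)).prod

open Polynomial Complex in
lemma fib_eval_aux (z : ℂ) (hz : z ≠ 0) (n : ℕ) :
    ((fibPoly n).map (Int.castRingHom ℂ)).eval (I * (z + z⁻¹)) * (z - z⁻¹) * I
      = I ^ n * (z ^ n - z⁻¹ ^ n) := by
  induction n using Nat.twoStepInduction with
  | zero => simp [fibPoly]
  | one => simp [fibPoly]; ring
  | more n h0 h1 =>
    have : ((fibPoly (n+2)).map (Int.castRingHom ℂ)).eval (I * (z + z⁻¹)) =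
      (I * (z + z⁻¹)) * ((fibPoly (n+1)).map (Int.castRingHom ℂ)).eval (I * (z + z⁻¹))
       + ((fibPoly n).map (Int.castRingHom ℂ)).eval (I * (z + z⁻¹)) := by
      simp [fibPoly]
    rw [this]
    have e : z * z⁻¹ = 1 := mul_inv_cancel₀ hz
    generalize z⁻¹ = w at *
    have hI : I * I = -1 := I_mul_I
    have k1 : z ^ (n+1) * w = z ^ n := by rw [pow_succ, mul_assoc, e, mul_one]
    have k2 : w ^ (n+1) * z = w ^ n := by rw [pow_succ, mul_assoc, mul_comm w z, e, mul_one]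
    have : I * (z + w) * (I ^ (n + 1) * (z ^ (n + 1) - w ^ (n + 1))) + I ^ n * (z ^ n - w ^ n)
       = I ^ (n + 2) * (z ^ (n + 2) - w ^ (n + 2)) := by
      have : I ^ (n + 2) = - I ^ n := by rw [pow_add, I_sq]; ring
      calc _ = I ^ (n+2) * (z^(n+2) - w^(n+1) * z + z^(n+1)*w - w ^ (n+2)) + I ^ n * (z ^ n - w ^ n) := by ring
        _ = _ := by rw [k1, k2, this]; ring
    linear_combination (I * (z+w)) * h1 + h0 + this

lemma divisor_prod_unique {f g : ℕ → ℂ} (n : ℕ) (hn : 1 ≤ n) (hg : ∀ d, d ∣ n → g d ≠ 0)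
    (h : ∀ m, 1 ≤ m → ∏ d ∈ m.divisors, f d = ∏ d ∈ m.divisors, g d) : f n = g n := by
  induction n using Nat.strong_induction_on with
  | _ n ih =>
    have hn' := h n hn
    rw [← Nat.cons_self_properDivisors (by omega), Finset.prod_cons, Finset.prod_cons] at hn'
    have : ∏ d ∈ n.properDivisors, f d = ∏ d ∈ n.properDivisors, g d := by
      refine Finset.prod_congr rfl fun d hd => ?_
      rw [Nat.mem_properDivisors] at hd
      exact ih d hd.2 (Nat.pos_of_dvd_of_pos hd.1 hn) (fun e he => hg e (he.trans hd.1))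
    rw [this] at hn'
    refine mul_right_cancel₀ ?_ hn'
    refine Finset.prod_ne_zero_iff.2 fun d hd => hg d (Nat.mem_properDivisors.1 hd).1

lemma divisor_sum_unique {f g : ℕ → ℕ} (n : ℕ) (hn : 1 ≤ n)
    (h : ∀ m, 1 ≤ m → ∑ d ∈ m.divisors, f d = ∑ d ∈ m.divisors, g d) : f n = g n := by
  induction n using Nat.strong_induction_on with
  | _ n ih =>
    have hn' := h n hn
    rw [← Nat.cons_self_properDivisors (by omega), Finset.sum_cons, Finset.sum_cons] at hn'
    have : ∑ d ∈ n.properDivisors, f d = ∑ d ∈ n.properDivisors, g d := by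
      refine Finset.sum_congr rfl fun d hd => ?_
      rw [Nat.mem_properDivisors] at hd
      exact ih d hd.2 (Nat.pos_of_dvd_of_pos hd.1 hn)
    omega

open Complex in
lemma key_generic (Ψ : ℕ → Polynomial ℤ) 
    (hΨprod : ∀ n, 1 ≤ n → fibPoly n = ∏ d ∈ n.divisors, Ψ d)
    (n : ℕ) (hn : 2 ≤ n) (z : ℂ) (hz : z ≠ 0) (hzn : z ^ (2 * n) ≠ 1) :
    ((Ψ n).map (Int.castRingHom ℂ)).eval (I * (z + z⁻¹)) =
      (I * z⁻¹) ^ Nat.totient n * (cyclotomic n ℂ).eval (z ^ 2) := by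
  have hIz : I * z⁻¹ ≠ 0 := mul_ne_zero I_ne_zero (inv_ne_zero hz)
  have := divisor_prod_unique
    (f := fun d => ((Ψ d).map (Int.castRingHom ℂ)).eval (I * (z + z⁻¹)) *
      (if d = 1 then (z - z⁻¹) * I else 1))
    (g := fun d => (I * z⁻¹) ^ Nat.totient d * (cyclotomic d ℂ).eval (z ^ 2)) n (by omega) ?_ ?_
  · simpa [show n ≠ 1 by omega] using this
  · intro d hd
    refine mul_ne_zero (pow_ne_zero _ hIz) fun h => hzn ?_
    have h1 : (X ^ n - 1 : ℂ[X]).eval (z ^ 2) = 0 :=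
      eval_eq_zero_of_dvd_of_eval_eq_zero
        ((cyclotomic.dvd_X_pow_sub_one d ℂ).trans (by
          obtain ⟨k, rfl⟩ := hd
          rw [pow_mul]; simpa using sub_dvd_pow_sub_pow (X ^ d : ℂ[X]) 1 k)) h
    rw [pow_mul]
    simpa [sub_eq_zero] using h1
  · intro m hm
    have hm0 : 0 < m := hm
    rw [Finset.prod_mul_distrib, Finset.prod_mul_distrib, Finset.prod_pow_eq_pow_sum,
      Nat.sum_totient, ← Polynomial.eval_prod, ← Polynomial.eval_prod,
      prod_cyclotomic_eq_X_pow_sub_one hm0, ← Polynomial.map_prod, ← hΨprod m hm,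
      Finset.prod_ite_eq' , if_pos (Nat.one_mem_divisors.2 hm0.ne'), ← mul_assoc,
      fib_eval_aux z hz]
    simp only [eval_sub, eval_pow, eval_X, eval_one]
    have e : z⁻¹ ^ m * z ^ m = 1 := by rw [← mul_pow, inv_mul_cancel₀ hz, one_pow]
    rw [mul_pow, ← pow_mul, mul_comm 2 m, pow_mul]
    linear_combination (- I ^ m * z ^ m) * e

open Complex in
lemma key_all (Ψ : ℕ → Polynomial ℤ) 
    (hΨprod : ∀ n, 1 ≤ n → fibPoly n = ∏ d ∈ n.divisors, Ψ d)
    (n : ℕ) (hn : 2 ≤ n) (z : ℂ) (hz : z ≠ 0) :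
    ((Ψ n).map (Int.castRingHom ℂ)).eval (I * (z + z⁻¹)) =
      (I * z⁻¹) ^ Nat.totient n * (cyclotomic n ℂ).eval (z ^ 2) := by
  have hfin : {w : ℂ | w ^ (2 * n) = 1}.Finite := by
    have hne : (X ^ (2 * n) - C 1 : ℂ[X]) ≠ 0 := X_pow_sub_C_ne_zero (by omega) 1
    refine (finite_setOfPred_isRoot hne).subset fun w hw => ?_
    simpa [sub_eq_zero] using hw
  have hev : ∀ᶠ w in nhdsWithin z {z}ᶜ, w ≠ 0 ∧ w ^ (2 * n) ≠ 1 := by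
    refine Filter.Eventually.and (eventually_nhdsWithin_of_eventually_nhds (eventually_ne_nhds hz)) ?_
    have h2 : ({w : ℂ | w ^ (2 * n) = 1} \ {z})ᶜ ∈ nhds z :=
      (hfin.subset Set.sdiff_subset).isClosed.isOpen_compl.mem_nhds (by simp)
    filter_upwards [mem_nhdsWithin_of_mem_nhds h2, self_mem_nhdsWithin] with w hw hw2 hw3
    exact hw ⟨hw3, hw2⟩
  have hinv : ContinuousAt (fun w : ℂ => w⁻¹) z := continuousAt_inv₀ hz
  have c1 : ContinuousAt (fun w : ℂ => ((Ψ n).map (Int.castRingHom ℂ)).eval (I * (w + w⁻¹))) z :=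
    ContinuousAt.comp (g := fun x => ((Ψ n).map (Int.castRingHom ℂ)).eval x)
      (Polynomial.continuous _).continuousAt (by fun_prop)
  have c2 : ContinuousAt (fun w : ℂ => (I * w⁻¹) ^ Nat.totient n * (cyclotomic n ℂ).eval (w ^ 2)) z :=
    ContinuousAt.mul (by fun_prop) (ContinuousAt.comp (g := fun x => (cyclotomic n ℂ).eval x)
      (Polynomial.continuous _).continuousAt (by fun_prop))
  refine tendsto_nhds_unique_of_eventuallyEq (c1.mono_left nhdsWithin_le_nhds)
    (c2.mono_left nhdsWithin_le_nhds) (l := nhdsWithin z {z}ᶜ) ?_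
  filter_upwards [hev] with w hw
  exact key_generic Ψ hΨprod n hn w hw.1 hw.2

open Complex in
lemma key_deriv (Ψ : ℕ → Polynomial ℤ) 
    (hΨprod : ∀ n, 1 ≤ n → fibPoly n = ∏ d ∈ n.divisors, Ψ d)
    (n : ℕ) (hn : 2 ≤ n) (z : ℂ) (hz : z ≠ 0) (h0 : (cyclotomic n ℂ).eval (z ^ 2) = 0) :
    ((Ψ n).map (Int.castRingHom ℂ)).derivative.eval (I * (z + z⁻¹)) * (I * (1 - (z ^ 2)⁻¹)) =
      (I * z⁻¹) ^ Nat.totient n * ((cyclotomic n ℂ).derivative.eval (z ^ 2) * (2 * z)) := by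
  have d1 : HasDerivAt (fun w : ℂ => ((Ψ n).map (Int.castRingHom ℂ)).eval (I * (w + w⁻¹)))
      (((Ψ n).map (Int.castRingHom ℂ)).derivative.eval (I * (z + z⁻¹)) * (I * (1 + -(z ^ 2)⁻¹))) z :=
    HasDerivAt.comp z (Polynomial.hasDerivAt _ _)
      (((hasDerivAt_id z).add (hasDerivAt_inv hz)).const_mul I)
  have d2 : HasDerivAt (fun w : ℂ => (cyclotomic n ℂ).eval (w ^ 2))
      ((cyclotomic n ℂ).derivative.eval (z ^ 2) * (2 * z)) z := by
    refine HasDerivAt.comp z (h := fun w : ℂ => w ^ 2) (Polynomial.hasDerivAt _ _) ?_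
    simpa using hasDerivAt_pow 2 z
  have d3 := (((hasDerivAt_inv hz).const_mul I).pow (Nat.totient n)).mul d2
  have d4 := d1.congr_of_eventuallyEq (f₁ := _) (Filter.EventuallyEq.symm
    ((eventually_ne_nhds hz).mono fun w hw => key_all Ψ hΨprod n hn w hw))
  have := d4.unique d3
  rw [h0] at this
  rw [sub_eq_add_neg, this]
  simp

lemma fib_deg (n : ℕ) : (fibPoly (n + 1)).Monic ∧ (fibPoly (n + 1)).natDegree = n := by
  induction n using Nat.twoStepInduction with
  | zero => simp [fibPoly]
  | one => simp [fibPoly]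
  | more n h0 h1 =>
    have e : fibPoly (n + 2 + 1) = X * fibPoly (n + 1 + 1) + fibPoly (n + 1) := rfl
    have hX : (X * fibPoly (n + 1 + 1)).Monic := monic_X.mul h1.1
    have hd : (X * fibPoly (n + 1 + 1)).natDegree = n + 2 := by
      rw [monic_X.natDegree_mul h1.1, h1.2, natDegree_X]; omega
    have hlt : (fibPoly (n + 1)).natDegree < (X * fibPoly (n + 1 + 1)).natDegree := by omega
    rw [e]
    exact ⟨hX.add_of_left (degree_lt_degree hlt), by rw [natDegree_add_eq_left_of_natDegree_lt hlt, hd]⟩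

lemma psi_deg (Ψ : ℕ → Polynomial ℤ) (hΨmonic : ∀ n, 1 ≤ n → (Ψ n).Monic)
    (hΨprod : ∀ n, 1 ≤ n → fibPoly n = ∏ d ∈ n.divisors, Ψ d) (n : ℕ) (hn : 2 ≤ n) :
    (Ψ n).natDegree = Nat.totient n := by
  have := divisor_sum_unique (f := fun d => (Ψ d).natDegree + if d = 1 then 1 else 0)
    (g := Nat.totient) n (by omega) ?_
  · simpa [show n ≠ 1 by omega] using this
  · intro m hm
    rw [Nat.sum_totient, Finset.sum_add_distrib, ← natDegree_prod_of_monic, ← hΨprod m hm,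
      Finset.sum_ite_eq', if_pos (Nat.one_mem_divisors.2 (by omega))]
    · obtain ⟨k, rfl⟩ : ∃ k, m = k + 1 := ⟨m - 1, by omega⟩
      rw [(fib_deg k).2]
    · intro d hd
      exact hΨmonic d (Nat.pos_of_mem_divisors hd)

lemma roots_eq_map {f : ℂ[X]} (hf : f ≠ 0) (S : Finset ℕ) (r : ℕ → ℂ)
    (hinj : Set.InjOn r S) (hr : ∀ k ∈ S, f.eval (r k) = 0) (hd : f.natDegree ≤ S.card) :
    f.roots = S.val.map r := by
  symm
  refine Multiset.eq_of_le_of_card_le ?_ ?_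
  · rw [Multiset.le_iff_subset]
    · intro x hx
      obtain ⟨k, hk, rfl⟩ := Multiset.mem_map.1 hx
      exact (mem_roots hf).2 (hr k hk)
    · exact S.nodup.map_on fun x hx y hy h => hinj hx hy h
  · rw [Multiset.card_map]
    exact (card_roots' f).trans hd

/-- The residues coprime to `n`. -/
def cop (n : ℕ) : Finset ℕ := (Finset.range n).filter n.Coprime

lemma mem_cop {n k : ℕ} : k ∈ cop n ↔ k < n ∧ n.Coprime k := by simp [cop]

lemma cop_pos {n k : ℕ} (hn : 2 ≤ n) (h : k ∈ cop n) : 0 < k := by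
  rcases Nat.eq_zero_or_pos k with rfl | h'
  · have := (mem_cop.1 h).2
    simp at this; omega
  · exact h'

lemma cop_reflect {n : ℕ} (hn : 2 ≤ n) {M : Type*} [CommMonoid M] (f : ℕ → M) :
    ∏ k ∈ cop n, f (n - k) = ∏ k ∈ cop n, f k := by
  have hm : ∀ k ∈ cop n, n - k ∈ cop n := by
    intro k hk
    have h1 := mem_cop.1 hk
    have h2 := cop_pos hn hk
    rw [mem_cop]
    exact ⟨by omega, (Nat.coprime_self_sub_right h1.1.le).2 h1.2⟩
  refine Finset.prod_nbij' (fun k => n - k) (fun k => n - k) hm hm ?_ ?_ fun _ _ => rfl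
  all_goals
    intro k hk
    have h1 := mem_cop.1 hk
    omega

/-- Half-angle roots of unity. -/
noncomputable def zz (n k : ℕ) : ℂ := Complex.exp ((Real.pi * (k / n) : ℝ) * Complex.I)

lemma zz_sq (n k : ℕ) : zz n k ^ 2 = Complex.exp (2 * Real.pi * Complex.I * (k / n)) := by
  rw [zz, ← Complex.exp_nat_mul]; congr 1; push_cast; ring

lemma zz_x (n k : ℕ) : zz n k + (zz n k)⁻¹ = ((2 * Real.cos (Real.pi * (k / n)) : ℝ) : ℂ) := by
  rw [zz, ← Complex.exp_neg]
  push_cast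
  rw [Complex.cos]
  ring_nf

open Complex in
lemma zz_prod {n : ℕ} (hn : 2 ≤ n) : ∏ k ∈ cop n, (I * (zz n k)⁻¹) = 1 := by
  have h : ∀ k, I * (zz n k)⁻¹ = exp ((Real.pi / 2 - Real.pi * (k / n) : ℝ) * I) := by
    intro k
    rw [zz, ← exp_neg]
    nth_rw 1 [← exp_pi_div_two_mul_I]
    rw [← exp_add]; congr 1; push_cast; ring
  simp_rw [h]
  rw [← exp_sum, ← Finset.sum_mul, ← ofReal_sum]
  have hs : ∑ k ∈ cop n, (Real.pi / 2 - Real.pi * ((k : ℝ) / n)) = 0 := by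
    have h1 := cop_reflect hn (fun k => Multiplicative.ofAdd (Real.pi / 2 - Real.pi * ((k : ℝ) / n)))
    rw [← ofAdd_sum, ← ofAdd_sum] at h1
    have h1 := Multiplicative.ofAdd.injective h1
    have h2 : ∑ k ∈ cop n, (Real.pi / 2 - Real.pi * (((n - k : ℕ) : ℝ) / n))
        = - ∑ k ∈ cop n, (Real.pi / 2 - Real.pi * ((k : ℝ) / n)) := by
      rw [← Finset.sum_neg_distrib]
      refine Finset.sum_congr rfl fun k hk => ?_
      rw [Nat.cast_sub (mem_cop.1 hk).1.le]
      have : (n : ℝ) ≠ 0 := by positivity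
      field_simp
      ring
    linarith
  rw [hs]; simp

lemma zz_prim {n k : ℕ} (hn : 2 ≤ n) (hk : k ∈ cop n) : IsPrimitiveRoot (zz n k ^ 2) n := by
  rw [zz_sq]
  exact Complex.isPrimitiveRoot_exp_of_coprime k n (by omega) (mem_cop.1 hk).2.symm

lemma ang_mem {n k : ℕ} (hn : 2 ≤ n) (hk : k ∈ cop n) :
    Real.pi * ((k : ℝ) / n) ∈ Set.Icc 0 Real.pi := by
  have h1 : (k : ℝ) ≤ n := by exact_mod_cast (mem_cop.1 hk).1.le
  refine ⟨by positivity, ?_⟩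
  have : (k : ℝ) / n ≤ 1 := div_le_one_of_le₀ h1 (by positivity)
  nlinarith [Real.pi_pos]

lemma x_inj {n : ℕ} (hn : 2 ≤ n) :
    Set.InjOn (fun k => Complex.I * (zz n k + (zz n k)⁻¹)) (cop n) := by
  intro a ha b hb h
  have h := mul_left_cancel₀ Complex.I_ne_zero h
  rw [zz_x, zz_x] at h
  have h := Complex.ofReal_injective h
  have h := Real.injOn_cos (ang_mem hn ha) (ang_mem hn hb) (by linarith)
  have h := mul_left_cancel₀ Real.pi_ne_zero h
  have : (n : ℝ) ≠ 0 := by positivity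
  field_simp at h
  exact_mod_cast h

lemma zeta_inj {n : ℕ} (hn : 2 ≤ n) :
    Set.InjOn (fun k => zz n k ^ 2) (cop n) := by
  have e : ∀ k, zz n k ^ 2 = Complex.exp (2 * Real.pi * Complex.I / n) ^ k := by
    intro k
    rw [zz_sq, ← Complex.exp_nat_mul]; congr 1; ring
  intro a ha b hb h
  simp only [e] at h
  exact (Complex.isPrimitiveRoot_exp n (by omega)).pow_inj (mem_cop.1 ha).1 (mem_cop.1 hb).1 h

lemma zz_sq_inv {n k : ℕ} (hn : 2 ≤ n) (hk : k ∈ cop n) : (zz n k ^ 2)⁻¹ = zz n (n - k) ^ 2 := by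
  rw [zz_sq, zz_sq, ← Complex.exp_neg, Nat.cast_sub (mem_cop.1 hk).1.le, Complex.exp_eq_exp_iff_exists_int]
  refine ⟨-1, ?_⟩
  have : (n : ℂ) ≠ 0 := by exact_mod_cast (by omega : n ≠ 0)
  field_simp
  push_cast
  ring

lemma cyc_roots {n : ℕ} (hn : 2 ≤ n) :
    (cyclotomic n ℂ).roots = (cop n).val.map (fun k => zz n k ^ 2) := by
  refine roots_eq_map (cyclotomic_ne_zero n ℂ) _ _ (zeta_inj hn) ?_ ?_
  · intro k hk
    exact (zz_prim hn hk).isRoot_cyclotomic (by omega)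
  · rw [natDegree_cyclotomic]; rfl

lemma prod_one_sub {n : ℕ} (hn : 2 ≤ n) :
    ∏ k ∈ cop n, (1 - (zz n k ^ 2)⁻¹) = (cyclotomic n ℂ).eval 1 := by
  rw [Finset.prod_congr rfl fun k hk => by rw [zz_sq_inv hn hk],
    cop_reflect hn (fun k => 1 - zz n k ^ 2)]
  have h := (IsAlgClosed.splits (cyclotomic n ℂ)).eq_prod_roots_of_monic (cyclotomic.monic n ℂ)
  rw [h, cyc_roots hn, Multiset.map_map]
  change _ = eval 1 (∏ k ∈ cop n, _)
  rw [eval_prod]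
  simp

open Complex in
lemma main_ratio (Ψ : ℕ → Polynomial ℤ) (hΨmonic : ∀ n, 1 ≤ n → (Ψ n).Monic)
    (hΨprod : ∀ n, 1 ≤ n → fibPoly n = ∏ d ∈ n.divisors, Ψ d) (n : ℕ) (hn : 2 ≤ n)
    (h1 : (cyclotomic n ℂ).eval 1 ≠ 0) :
    discC ((Ψ n).map (Int.castRingHom ℂ)) / discC (cyclotomic n ℂ) =
      2 ^ Nat.totient n / (cyclotomic n ℂ).eval 1 := by
  have hz : ∀ k, zz n k ≠ 0 := fun k => exp_ne_zero _
  have hc0 : ∀ k ∈ cop n, (cyclotomic n ℂ).eval (zz n k ^ 2) = 0 := fun k hk =>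
    (zz_prim hn hk).isRoot_cyclotomic (by omega)
  have hcard : (cop n).card = Nat.totient n := rfl
  have hroots : ((Ψ n).map (Int.castRingHom ℂ)).roots =
      (cop n).val.map (fun k => I * (zz n k + (zz n k)⁻¹)) := by
    refine roots_eq_map ((hΨmonic n (by omega)).map _).ne_zero _ _ (x_inj hn) ?_ ?_
    · intro k hk
      rw [key_all Ψ hΨprod n hn _ (hz k), hc0 k hk, mul_zero]
    · rw [(hΨmonic n (by omega)).natDegree_map, psi_deg Ψ hΨmonic hΨprod n hn, hcard]
  have hD : discC (cyclotomic n ℂ) = ∏ k ∈ cop n, (cyclotomic n ℂ).derivative.eval (zz n k ^ 2) := by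
    rw [discC, cyc_roots hn, Multiset.map_map]; rfl
  have hE : discC ((Ψ n).map (Int.castRingHom ℂ)) =
      ∏ k ∈ cop n, ((Ψ n).map (Int.castRingHom ℂ)).derivative.eval (I * (zz n k + (zz n k)⁻¹)) := by
    rw [discC, hroots, Multiset.map_map]; rfl
  have hDne : discC (cyclotomic n ℂ) ≠ 0 := by
    rw [hD]
    refine Finset.prod_ne_zero_iff.2 fun k hk h => ?_
    have : NeZero (n : ℂ) := ⟨by exact_mod_cast (by omega : n ≠ 0)⟩
    have hs : (cyclotomic n ℂ).Separable := separable_cyclotomic n ℂ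
    exact hs.eval₂_derivative_ne_zero (RingHom.id ℂ) (by simpa [eval₂_id] using hc0 k hk)
      (by simpa [eval₂_id] using h)
  have hk : ∀ k ∈ cop n,
      ((Ψ n).map (Int.castRingHom ℂ)).derivative.eval (I * (zz n k + (zz n k)⁻¹)) *
        ((I * (zz n k)⁻¹) * (1 - (zz n k ^ 2)⁻¹)) =
      (I * (zz n k)⁻¹) ^ Nat.totient n * ((cyclotomic n ℂ).derivative.eval (zz n k ^ 2) * 2) := by
    intro k hk
    have := key_deriv Ψ hΨprod n hn _ (hz k) (hc0 k hk)
    have e := mul_inv_cancel₀ (hz k)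
    generalize (I * (zz n k)⁻¹) ^ Nat.totient n = A at *
    linear_combination (zz n k)⁻¹ * this + (2 * A * (cyclotomic n ℂ).derivative.eval (zz n k ^ 2)) * e
  have hP := Finset.prod_congr rfl hk
  simp only [Finset.prod_mul_distrib, Finset.prod_pow] at hP
  have hzp := zz_prod hn
  rw [Finset.prod_mul_distrib] at hzp
  have h1' := prod_one_sub hn
  rw [h1', hzp, ← hE, ← hD, Finset.prod_const, hcard, one_pow] at hP
  rw [div_eq_div_iff hDne h1]
  linear_combination hP

theorem fibotomic_disc_div_cyclotomic_disc
    (Ψ : ℕ → Polynomial ℤ) (hΨ1 : Ψ 1 = 1)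
    (hΨmonic : ∀ n, 1 ≤ n → (Ψ n).Monic)
    (hΨprod : ∀ n, 1 ≤ n → fibPoly n = ∏ d ∈ n.divisors, Ψ d)
    (n : ℕ) (hn : 2 ≤ n) :
    (∀ p α : ℕ, p.Prime → 0 < α → n = p ^ α →
      discC ((Ψ n).map (Int.castRingHom ℂ)) / discC (Polynomial.cyclotomic n ℂ) =
        2 ^ Nat.totient n / p) ∧
    ((¬∃ p α : ℕ, p.Prime ∧ 0 < α ∧ n = p ^ α) →
      discC ((Ψ n).map (Int.castRingHom ℂ)) / discC (Polynomial.cyclotomic n ℂ) =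
        2 ^ Nat.totient n) := by
  constructor
  · rintro p α hp hα rfl
    have := Fact.mk hp
    obtain ⟨k, rfl⟩ : ∃ k, α = k + 1 := ⟨α - 1, by omega⟩
    have e : (cyclotomic (p ^ (k + 1)) ℂ).eval 1 = p := eval_one_cyclotomic_prime_pow k
    rw [main_ratio Ψ hΨmonic hΨprod _ hn (by rw [e]; exact_mod_cast hp.ne_zero), e]
  · intro h
    have e : (cyclotomic n ℂ).eval 1 = 1 := by
      refine eval_one_cyclotomic_not_prime_pow fun {p} hp k hk => ?_
      refine h ⟨p, k, hp, Nat.pos_of_ne_zero ?_, hk.symm⟩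
      rintro rfl
      simp at hk; omega
    rw [main_ratio Ψ hΨmonic hΨprod _ hn (by rw [e]; exact one_ne_zero), e, div_one]
end

section
/- For all integers 2 ≤ m < n, the resultant of the fibotomic polynomials satisfies res(Ψ_m(x), Ψ_n(x)) = res(Φ_m(x), Φ_n(x)), where Φ denotes cyclotomic polynomials. -/
open Polynomial

/-- The resultant of two monic polynomials that split over `ℂ`, computed as
`∏_{i,j} (αᵢ - βⱼ)` over the roots `αᵢ` of `f` and `βⱼ` of `g`. -/
noncomputable def resC (f g : Polynomial ℂ) : ℂ :=
  (f.roots.map (fun a => (g.roots.map (fun b => a - b)).prod)).prod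

lemma fib_eval (a : ℂ) (ha : a ≠ 0) (n : ℕ) :
    (a + a⁻¹) * ((fibPoly n).map (Int.castRingHom ℂ)).eval (a - a⁻¹) =
      (-a⁻¹) ^ n * ((-a ^ 2) ^ n - 1) := by
  have e : (-a⁻¹) ^ n * ((-a ^ 2) ^ n - 1) = a ^ n - (-a⁻¹) ^ n := by
    rw [mul_sub, ← mul_pow, mul_one]
    congr 2
    field_simp
  rw [e]
  clear e
  induction n using Nat.twoStepInduction with
  | zero => simp [fibPoly]
  | one => simp [fibPoly]
  | more k h1 h2 =>
    simp only [fibPoly, Polynomial.map_add, Polynomial.map_mul, map_X, eval_add, eval_mul, eval_X]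
    have : (a + a⁻¹) * ((a - a⁻¹) * ((fibPoly (k+1)).map (Int.castRingHom ℂ)).eval (a - a⁻¹)
        + ((fibPoly k).map (Int.castRingHom ℂ)).eval (a - a⁻¹)) =
      (a - a⁻¹) * (a ^ (k+1) - (-a⁻¹) ^ (k+1)) + (a ^ k - (-a⁻¹) ^ k) := by
      rw [← h1, ← h2]; ring
    rw [this]
    have h : a * a⁻¹ = 1 := mul_inv_cancel₀ ha
    linear_combination (-(a ^ k) + (-a⁻¹) ^ k) * h

/-- The value of the extended factor: `Ψ_1` is replaced by `a + a⁻¹`. -/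
lemma psi_eval_aux (Ψ : ℕ → Polynomial ℤ) (hΨ1 : Ψ 1 = 1)
    (hΨprod : ∀ n, 1 ≤ n → fibPoly n = ∏ d ∈ n.divisors, Ψ d) (n : ℕ) (hn : 1 ≤ n) :
    ∀ a : ℂ, a ≠ 0 →
      (if n = 1 then a + a⁻¹ else 1) * ((Ψ n).map (Int.castRingHom ℂ)).eval (a - a⁻¹) =
        (-a⁻¹) ^ n.totient * (cyclotomic n ℂ).eval (-a ^ 2) := by
  induction n using Nat.strong_induction_on with
  | _ n ih =>
  -- generic case
  have gen : ∀ a : ℂ, a ≠ 0 → (-a ^ 2) ^ n ≠ 1 →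
      (if n = 1 then a + a⁻¹ else 1) * ((Ψ n).map (Int.castRingHom ℂ)).eval (a - a⁻¹) =
        (-a⁻¹) ^ n.totient * (cyclotomic n ℂ).eval (-a ^ 2) := by
    intro a ha hw
    have h0 : n ≠ 0 := by omega
    have h1 := fib_eval a ha n
    have hL : ∏ d ∈ n.divisors, ((if d = 1 then a + a⁻¹ else 1) *
        ((Ψ d).map (Int.castRingHom ℂ)).eval (a - a⁻¹)) =
        (a + a⁻¹) * ((fibPoly n).map (Int.castRingHom ℂ)).eval (a - a⁻¹) := by
      rw [Finset.prod_mul_distrib, hΨprod n hn, Polynomial.map_prod, eval_prod]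
      congr 1
      rw [Finset.prod_ite_eq']
      simp [h0]
    have hR : ∏ d ∈ n.divisors, ((-a⁻¹) ^ d.totient * (cyclotomic d ℂ).eval (-a ^ 2)) =
        (-a⁻¹) ^ n * ((-a ^ 2) ^ n - 1) := by
      rw [Finset.prod_mul_distrib, Finset.prod_pow_eq_pow_sum, Nat.sum_totient, ← eval_prod,
        prod_cyclotomic_eq_X_pow_sub_one (by omega)]
      simp
    have hne : ∏ d ∈ n.divisors, ((-a⁻¹) ^ d.totient * (cyclotomic d ℂ).eval (-a ^ 2)) ≠ 0 := by
      rw [hR]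
      exact mul_ne_zero (pow_ne_zero _ (neg_ne_zero.2 (inv_ne_zero ha))) (sub_ne_zero.2 hw)
    have hE := hL.trans (h1.trans hR.symm)
    have hP : ∏ d ∈ n.properDivisors, ((if d = 1 then a + a⁻¹ else 1) *
        ((Ψ d).map (Int.castRingHom ℂ)).eval (a - a⁻¹)) =
        ∏ d ∈ n.properDivisors, ((-a⁻¹) ^ d.totient * (cyclotomic d ℂ).eval (-a ^ 2)) := by
      refine Finset.prod_congr rfl fun d hd => ?_
      have := Nat.mem_properDivisors.1 hd
      exact ih d this.2 (Nat.pos_of_dvd_of_pos this.1 hn) a ha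
    rw [← Nat.cons_self_properDivisors h0, Finset.prod_cons] at hne
    rw [← Nat.cons_self_properDivisors h0, Finset.prod_cons, Finset.prod_cons, hP] at hE
    exact mul_right_cancel₀ (right_ne_zero_of_mul hne) hE
  intro a ha
  have hfin : Set.Finite {z : ℂ | (-z ^ 2) ^ n = 1} := by
    have hp : ((-X ^ 2) ^ n - 1 : ℂ[X]) ≠ 0 := by
      intro h
      have := congrArg (eval 0) h
      simp [show n ≠ 0 by omega] at this
    refine (Polynomial.finite_setOfPred_isRoot hp).subset fun z hz => ?_
    simp only [Set.mem_ofPred_eq] at hz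
    simp [hz]
  have hd : Dense ({z : ℂ | (-z ^ 2) ^ n = 1} ∪ {0})ᶜ :=
    (hfin.union (Set.finite_singleton 0)).countable.dense_compl ℝ
  have hfr := mem_closure_iff_frequently.1 (hd a)
  have c1 : ContinuousAt (fun a : ℂ => (if n = 1 then a + a⁻¹ else 1) *
      ((Ψ n).map (Int.castRingHom ℂ)).eval (a - a⁻¹)) a := by
    refine ContinuousAt.mul ?_ ?_
    · split_ifs
      · exact continuousAt_id.add (continuousAt_inv₀ ha)
      · exact continuousAt_const
    · exact (Polynomial.continuous _).continuousAt.comp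
        (continuousAt_id.sub (continuousAt_inv₀ ha))
  have c2 : ContinuousAt (fun a : ℂ =>
      (-a⁻¹) ^ n.totient * (cyclotomic n ℂ).eval (-a ^ 2)) a := by
    refine ContinuousAt.mul ((continuousAt_inv₀ ha).neg.pow _) ?_
    exact ((Polynomial.continuous _).comp (by fun_prop : Continuous fun a : ℂ => -a ^ 2)).continuousAt
  refine tendsto_nhds_unique_of_frequently_eq c1 c2 (hfr.mono fun z hz => ?_)
  simp only [Set.mem_compl_iff, Set.mem_union, Set.mem_ofPred_eq, Set.mem_singleton_iff,
    not_or] at hz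
  exact gen z hz.2 hz.1

lemma exists_param (x : ℂ) : ∃ a : ℂ, a ≠ 0 ∧ a - a⁻¹ = x := by
  obtain ⟨s, hs⟩ := IsAlgClosed.exists_pow_nat_eq (x ^ 2 + 4) (n := 2) (by norm_num)
  have h : ((x + s) / 2) * ((s - x) / 2) = 1 := by linear_combination hs / 4
  have h0 : (x + s) / 2 ≠ 0 := left_ne_zero_of_mul_eq_one h
  refine ⟨(x + s) / 2, h0, ?_⟩
  rw [inv_eq_of_mul_eq_one_right h]
  ring

/-- A monic complex polynomial evaluated as a product over its roots. -/
lemma eval_monic_eq (p : ℂ[X]) (hp : p.Monic) (x : ℂ) :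
    p.eval x = (p.roots.map (fun b => x - b)).prod :=
  (IsAlgClosed.splits p).eval_eq_prod_roots_of_monic hp x

lemma resC_eq (f g : ℂ[X]) (hg : g.Monic) :
    resC f g = (f.roots.map (fun a => g.eval a)).prod := by
  unfold resC
  simp_rw [eval_monic_eq g hg]

lemma multiset_sq (p : ℂ[X]) (hp : p.Monic) (m : ℕ) (hm : 2 ≤ m)
    (h : ∀ a : ℂ, a ≠ 0 → p.eval (a - a⁻¹) =
      (-a⁻¹) ^ m.totient * (cyclotomic m ℂ).eval (-a ^ 2)) :
    p.roots.map (fun x => x ^ 2) =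
      (cyclotomic m ℂ).roots.map (fun z => -(z + 1) ^ 2 / z) := by
  have hcyc := cyclotomic.monic m ℂ
  have hcard : Multiset.card (cyclotomic m ℂ).roots = m.totient := by
    rw [← (IsAlgClosed.splits (cyclotomic m ℂ)).natDegree_eq_card_roots, natDegree_cyclotomic]
  have hroot0 : ∀ z ∈ (cyclotomic m ℂ).roots, z ≠ 0 := by
    rintro z hz rfl
    have h1 := (mem_roots'.1 hz).2
    rw [IsRoot, ← coeff_zero_eq_eval_zero, cyclotomic_coeff_zero ℂ (by omega)] at h1
    exact one_ne_zero h1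
  -- parity
  have hneg : ∀ x : ℂ, p.eval (-x) = (-1) ^ m.totient * p.eval x := by
    intro x
    obtain ⟨a, ha, rfl⟩ := exists_param x
    have e : -(a - a⁻¹) = (-a) - (-a)⁻¹ := by rw [inv_neg]; ring
    rw [e, h _ (neg_ne_zero.2 ha), h a ha, ← mul_assoc, ← mul_pow]
    congr 2
    · rw [inv_neg]; ring
    · ring
  have hdeg : ((-1 : ℂ)) ^ p.natDegree = (-1) ^ m.totient := by
    have hc : p.comp (-X) = C ((-1 : ℂ) ^ m.totient) * p := by
      refine Polynomial.funext fun x => ?_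
      rw [eval_comp, eval_neg, eval_X, hneg, eval_mul, eval_C]
    have hl := congrArg leadingCoeff hc
    rw [leadingCoeff_comp (by simp), leadingCoeff_mul, leadingCoeff_C, hp.leadingCoeff] at hl
    simpa using hl
  have key : ∀ x : ℂ, ((p.roots.map (fun x => x ^ 2)).map (fun c => x ^ 2 - c)).prod =
      (((cyclotomic m ℂ).roots.map (fun z => -(z + 1) ^ 2 / z)).map (fun c => x ^ 2 - c)).prod := by
    intro x
    have l1 : ((p.roots.map (fun x => x ^ 2)).map (fun c => x ^ 2 - c)).prod = p.eval x ^ 2 := by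
      rw [Multiset.map_map]
      have : ∀ b : ℂ, ((fun c => x ^ 2 - c) ∘ fun x => x ^ 2) b = (x - b) * ((-1) * (-x - b)) := by
        intro b; simp only [Function.comp]; ring
      simp_rw [this]
      rw [Multiset.prod_map_mul, Multiset.prod_map_mul, ← eval_monic_eq p hp,
        ← eval_monic_eq p hp, hneg, Multiset.map_const', Multiset.prod_replicate,
        ← (IsAlgClosed.splits p).natDegree_eq_card_roots, hdeg, ← mul_assoc (_ ^ _), ← mul_pow]
      norm_num [sq]
    rw [l1]
    obtain ⟨a, ha, rfl⟩ := exists_param x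
    rw [h a ha, Multiset.map_map]
    have t : ∀ z ∈ (cyclotomic m ℂ).roots, ((fun c => (a - a⁻¹) ^ 2 - c) ∘
        fun z => -(z + 1) ^ 2 / z) z =
        ((-a⁻¹) * (-a ^ 2 - z)) * ((-a⁻¹) * (-a ^ 2 - z⁻¹)) := by
      intro z hz
      have := hroot0 z hz
      simp only [Function.comp]
      field_simp
      ring
    have hinv : ((cyclotomic m ℂ).roots.map (fun z => -a ^ 2 - z⁻¹)).prod =
        ((cyclotomic m ℂ).roots.map (fun z => -a ^ 2 - z)).prod := by
      have : NeZero (m : ℂ) := ⟨by exact_mod_cast (by omega : m ≠ 0)⟩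
      rw [cyclotomic.roots_eq_primitiveRoots_val]
      change ∏ z ∈ primitiveRoots m ℂ, (-a ^ 2 - z⁻¹) = ∏ z ∈ primitiveRoots m ℂ, (-a ^ 2 - z)
      have hmem : ∀ z ∈ primitiveRoots m ℂ, z⁻¹ ∈ primitiveRoots m ℂ := fun z hz =>
        (mem_primitiveRoots (by omega)).2 ((mem_primitiveRoots (by omega)).1 hz).inv
      exact Finset.prod_nbij' (fun z => z⁻¹) (fun z => z⁻¹) hmem hmem
        (fun z _ => inv_inv z) (fun z _ => inv_inv z) (fun z _ => rfl)
    rw [Multiset.map_congr rfl t, Multiset.prod_map_mul, Multiset.prod_map_mul,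
      Multiset.prod_map_mul, hinv, ← eval_monic_eq _ hcyc, Multiset.map_const',
      Multiset.prod_replicate, hcard, sq]
  have hpoly : ((p.roots.map (fun x => x ^ 2)).map (fun c => X - C c)).prod =
      (((cyclotomic m ℂ).roots.map (fun z => -(z + 1) ^ 2 / z)).map (fun c => X - C c)).prod := by
    refine Polynomial.funext fun t => ?_
    obtain ⟨s, rfl⟩ := IsAlgClosed.exists_pow_nat_eq t (n := 2) (by norm_num)
    rw [eval_multiset_prod, eval_multiset_prod, Multiset.map_map, Multiset.map_map]
    simpa [Function.comp_def] using key s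
  have := congrArg roots hpoly
  rwa [roots_multiset_prod_X_sub_C, roots_multiset_prod_X_sub_C] at this

theorem fibotomic_res_eq_cyclotomic_res
    (Ψ : ℕ → Polynomial ℤ) (hΨ1 : Ψ 1 = 1)
    (hΨmonic : ∀ n, 1 ≤ n → (Ψ n).Monic)
    (hΨprod : ∀ n, 1 ≤ n → fibPoly n = ∏ d ∈ n.divisors, Ψ d)
    (m n : ℕ) (hm : 2 ≤ m) (hmn : m < n) :
    resC ((Ψ m).map (Int.castRingHom ℂ)) ((Ψ n).map (Int.castRingHom ℂ)) =
      resC (Polynomial.cyclotomic m ℂ) (Polynomial.cyclotomic n ℂ) := by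
  have hE : ∀ k, 2 ≤ k → ∀ a : ℂ, a ≠ 0 →
      ((Ψ k).map (Int.castRingHom ℂ)).eval (a - a⁻¹) =
      (-a⁻¹) ^ k.totient * (cyclotomic k ℂ).eval (-a ^ 2) := by
    intro k hk a ha
    have := psi_eval_aux Ψ hΨ1 hΨprod k (by omega) a ha
    rwa [if_neg (by omega), one_mul] at this
  have hM : ∀ k, 2 ≤ k → ((Ψ k).map (Int.castRingHom ℂ)).Monic :=
    fun k hk => (hΨmonic k (by omega)).map _
  have hms := multiset_sq _ (hM m hm) m hm (hE m hm)
  have hEn := hE n (by omega)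
  rw [resC_eq _ _ (hM n (by omega)), resC_eq _ _ (cyclotomic.monic n ℂ)]
  set q := (Ψ n).map (Int.castRingHom ℂ) with hq
  obtain ⟨r, hr⟩ := Nat.totient_even (n := n) (by omega)
  have hr' : n.totient = 2 * r := by omega
  have hroot0 : ∀ z ∈ (cyclotomic m ℂ).roots, z ≠ 0 := by
    rintro z hz rfl
    have h1 := (mem_roots'.1 hz).2
    rw [IsRoot, ← coeff_zero_eq_eval_zero, cyclotomic_coeff_zero ℂ (by omega)] at h1
    exact one_ne_zero h1
  choose s hs using fun t : ℂ => IsAlgClosed.exists_pow_nat_eq t (n := 2) (by norm_num)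
  have heven : ∀ x : ℂ, q.eval (-x) = q.eval x := by
    intro x
    obtain ⟨a, ha, rfl⟩ := exists_param x
    have e : -(a - a⁻¹) = (-a) - (-a)⁻¹ := by rw [inv_neg]; ring
    rw [e, hEn _ (neg_ne_zero.2 ha), hEn a ha, hr', pow_mul, pow_mul]
    congr 2
    · rw [inv_neg]; ring
    · ring
  have hsq : ∀ x y : ℂ, x ^ 2 = y ^ 2 → q.eval x = q.eval y := by
    intro x y hxy
    rcases sq_eq_sq_iff_eq_or_eq_neg.1 hxy with h | h
    · rw [h]
    · rw [h, heven]
  have e1 : (((Ψ m).map (Int.castRingHom ℂ)).roots.map (fun a => q.eval a)) =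
      (((Ψ m).map (Int.castRingHom ℂ)).roots.map (fun x => x ^ 2)).map
        (fun c => q.eval (s c)) := by
    rw [Multiset.map_map]
    refine Multiset.map_congr rfl fun x _ => ?_
    exact hsq _ _ (hs _).symm
  rw [e1, hms, Multiset.map_map]
  have e2 : ∀ z ∈ (cyclotomic m ℂ).roots, ((fun c => q.eval (s c)) ∘
      fun z => -(z + 1) ^ 2 / z) z = ((0 - z) ^ r)⁻¹ * (cyclotomic n ℂ).eval z := by
    intro z hz
    have hz0 := hroot0 z hz
    obtain ⟨a, ha⟩ := IsAlgClosed.exists_pow_nat_eq (-z) (n := 2) (by norm_num)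
    have ha0 : a ≠ 0 := by
      rintro rfl
      apply hz0
      simpa using ha.symm
    have hza : z = -a ^ 2 := by rw [ha, neg_neg]
    have : q.eval (s (-(z + 1) ^ 2 / z)) = q.eval (a - a⁻¹) := by
      apply hsq
      rw [hs, hza]
      field_simp
      ring
    simp only [Function.comp]
    rw [this, hEn a ha0, hr', pow_mul, hza]
    congr 1
    rw [← inv_pow]
    congr 1
    field_simp
    ring
  rw [Multiset.map_congr rfl e2, Multiset.prod_map_mul, Multiset.prod_map_inv,
    Multiset.prod_map_pow, ← eval_monic_eq _ (cyclotomic.monic m ℂ),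
    ← coeff_zero_eq_eval_zero, cyclotomic_coeff_zero ℂ (by omega)]
  simp
end
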